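/- Let X be a topological space, let τ be an infinite cardinal, and let K be an infinite subset of the underlying discrete set of A(τ), of cardinality κ. Let F(X,K) be the set of all continuous real-valued functions f on X × A(τ) such that f(x,β) = f(x,∞) for every x ∈ X and every β ∉ K ∪ {∞}, endowed with the subspace topology inherited from C_p(X × A(τ)). Then F(X,K) is homeomorphic to C_p(X × A(κ)). -/

import Mathlib

open Cardinal Set

universe u

/-- `Cp X` : the space of continuous real-valued functions on `X` with the topology of
pointwise convergence (subspace topology inherited from the product `ℝ^X`). -/
abbrev Cp (X : Type*) [TopologicalSpace X] := {f : X → ℝ // Continuous f}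

/-- A map between one-point compactifications of discrete spaces that fixes `∞` and has finite
fibres over the finite points is continuous. -/
theorem OnePoint.continuous_of_finite_fibers {D E : Type*} [TopologicalSpace D]
    [DiscreteTopology D] [TopologicalSpace E] [DiscreteTopology E]
    (f : OnePoint D → OnePoint E) (hf : f OnePoint.infty = OnePoint.infty)
    (hfin : ∀ e : E, {d : D | f d = e}.Finite) : Continuous f := by
  rw [OnePoint.continuous_iff_from_discrete, hf]
  intro s hs
  rw [OnePoint.nhds_infty_eq, Filter.coclosedCompact_eq_cocompact,
    Filter.cocompact_eq_cofinite] at hs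
  have hs' : {e : E | (e : OnePoint E) ∉ s}.Finite := hs.1
  have hinf : OnePoint.infty ∈ s := hs.2
  refine (hs'.biUnion fun e _ => hfin e).subset fun d hd => ?_
  have hd' : f d ∉ s := hd
  obtain ⟨e, he⟩ := OnePoint.ne_infty_iff_exists.1 fun h : f d = OnePoint.infty => hd' (h ▸ hinf)
  exact mem_biUnion (show (e : OnePoint E) ∉ s from he ▸ hd') he.symm

/-- A retraction `r` with continuous section `i` identifies `Cp Z` with the functions in `Cp Y`
that are invariant under `i ∘ r`, where the invariance is expressed by a predicate `P`. -/
def Cp.homeomorphOfRetraction {Y Z : Type*} [TopologicalSpace Y] [TopologicalSpace Z]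
    (r : Y → Z) (i : Z → Y) (hr : Continuous r) (hi : Continuous i)
    (hri : ∀ z, r (i z) = z) (P : Cp Y → Prop)
    (hP : ∀ f, P f ↔ ∀ y, f.1 (i (r y)) = f.1 y) : {f : Cp Y // P f} ≃ₜ Cp Z where
  toFun f := ⟨f.1.1 ∘ i, f.1.2.comp hi⟩
  invFun g := ⟨⟨g.1 ∘ r, g.2.comp hr⟩, (hP _).2 fun y => congrArg g.1 (hri (r y))⟩
  left_inv f := Subtype.ext <| Subtype.ext <| funext <| (hP f.1).1 f.2
  right_inv g := Subtype.ext <| funext fun z => congrArg g.1 (hri z)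
  continuous_toFun := by
    refine Continuous.subtype_mk (continuous_pi fun z => ?_) _
    exact (continuous_apply (i z)).comp (continuous_subtype_val.comp continuous_subtype_val)
  continuous_invFun := by
    refine Continuous.subtype_mk (Continuous.subtype_mk (continuous_pi fun y => ?_) _) _
    exact (continuous_apply (r y)).comp continuous_subtype_val

/-- Let `X` be a space, `τ` an infinite cardinal, `A(τ) = OnePoint D` for a
discrete space `D` of cardinality `τ`, and let `K ⊆ D` be infinite of cardinality `κ`.
The set `F(X,K)` of continuous real-valued functions `f` on `X × A(τ)` with
`f (x, β) = f (x, ∞)` for every `x ∈ X` and every `β ∉ K`, with the subspace topology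
inherited from `Cp (X × A(τ))`, is homeomorphic to `Cp (X × A(κ))`, where
`A(κ) = OnePoint E` for a discrete space `E` of cardinality `κ`. -/
theorem statement14 (X : Type u) [TopologicalSpace X]
    (τ : Cardinal.{u}) (hτ : ℵ₀ ≤ τ)
    (D : Type u) [TopologicalSpace D] [DiscreteTopology D] (hD : #D = τ)
    (K : Set D) (hKinf : K.Infinite) (κ : Cardinal.{u}) (hK : #K = κ)
    (E : Type u) [TopologicalSpace E] [DiscreteTopology E] (hE : #E = κ) :
    Nonempty
      ({f : Cp (X × OnePoint D) //
          ∀ (x : X) (β : D), β ∉ K → f.1 (x, (β : OnePoint D)) = f.1 (x, OnePoint.infty)}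
        ≃ₜ Cp (X × OnePoint E)) := by
  classical
  obtain ⟨e⟩ : Nonempty (K ≃ E) := Cardinal.eq.1 (hK.trans hE.symm)
  let r : OnePoint D → OnePoint E := fun y =>
    y.elim OnePoint.infty fun d =>
      if h : d ∈ K then (e ⟨d, h⟩ : OnePoint E) else OnePoint.infty
  let i : OnePoint E → OnePoint D := OnePoint.map fun z => (e.symm z : D)
  have r_mem (d : D) (h : d ∈ K) : r d = e ⟨d, h⟩ := dif_pos h
  have r_notMem (d : D) (h : d ∉ K) : r d = OnePoint.infty := dif_neg h
  have hr : Continuous r := by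
    refine OnePoint.continuous_of_finite_fibers r rfl fun z => ?_
    refine (finite_singleton (e.symm z : D)).subset fun d (hd : r d = z) => ?_
    by_cases h : d ∈ K
    · rw [r_mem d h, OnePoint.coe_eq_coe] at hd
      simp [← hd]
    · rw [r_notMem d h] at hd
      exact absurd hd (OnePoint.infty_ne_coe z)
  have hi : Continuous i := by
    refine OnePoint.continuous_of_finite_fibers i rfl fun d => ?_
    refine Set.Subsingleton.finite fun a (ha : i a = d) b (hb : i b = d) => ?_
    exact e.symm.injective (Subtype.ext (OnePoint.coe_injective (ha.trans hb.symm)))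
  have hri (z : OnePoint E) : r (i z) = z := by
    induction z using OnePoint.rec with
    | infty => rfl
    | coe z => exact (r_mem _ (e.symm z).2).trans (by simp)
  refine ⟨Cp.homeomorphOfRetraction (Prod.map id r) (Prod.map id i) (continuous_id.prodMap hr)
    (continuous_id.prodMap hi) (fun z => Prod.ext rfl (hri z.2)) _ fun f => ⟨?_, ?_⟩⟩
  · rintro hf ⟨x, y⟩
    change f.1 (x, i (r y)) = f.1 (x, y)
    induction y using OnePoint.rec with
    | infty => rfl
    | coe d =>
      by_cases h : d ∈ K
      · rw [r_mem d h]
        change f.1 (x, ((e.symm (e ⟨d, h⟩) : D) : OnePoint D)) = _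
        rw [e.symm_apply_apply]
      · rw [r_notMem d h]
        exact (hf x d h).symm
  · intro hf x d h
    have hxd : f.1 (x, i (r d)) = f.1 (x, d) := hf (x, d)
    rw [r_notMem d h] at hxd
    exact hxd.symm
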